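/- With the algorithm setup (n = dℓ, k = dr + c, c ∈ {−1,0,1}): for any 1 ≤ s ≤ ℓ − r + 1 and any I ∈ B_s, the collection of ρ^ℓ-translates {I +_n xℓ : 0 ≤ x ≤ d − 1} is weakly separated. -/

import Mathlib

open Finset

/-- `x +_n t`: add `t` to `x ∈ [n] = {1,…,n}` modulo `n`, with representative in `[n]`. -/
def shiftMod (n t x : ℕ) : ℕ := (x + t - 1) % n + 1

/-- `S +_n t`: add `t` to every element of `S ⊆ [n]` modulo `n`. -/
def shiftSet (n t : ℕ) (S : Finset ℕ) : Finset ℕ := S.image (shiftMod n t)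

/-- `x +_n t` for an integer shift `t`. -/
def shiftModZ (n : ℕ) (t : ℤ) (x : ℕ) : ℕ := ((((x : ℤ) + t - 1) % (n : ℤ)) + 1).toNat

/-- `S +_n t` for an integer shift `t`. -/
def shiftSetZ (n : ℕ) (t : ℤ) (S : Finset ℕ) : Finset ℕ := S.image (shiftModZ n t)

/-- Two sets `S`, `T` are weakly separated if there are no `a < b < c < d` with
`a, c ∈ S \ T` and `b, d ∈ T \ S`, nor with the roles of `S` and `T` exchanged. -/
def WeaklySeparated (S T : Finset ℕ) : Prop :=
  ¬ ∃ a b c d : ℕ, a < b ∧ b < c ∧ c < d ∧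
    ((a ∈ S \ T ∧ c ∈ S \ T ∧ b ∈ T \ S ∧ d ∈ T \ S) ∨
     (a ∈ T \ S ∧ c ∈ T \ S ∧ b ∈ S \ T ∧ d ∈ S \ T))

/-- The cyclic successor of `x` in a finite set `P ⊆ ℕ`: the least element of `P`
greater than `x` if one exists, and otherwise the least element of `P`. -/
def cyclicSucc (P : Finset ℕ) (x : ℕ) : ℕ :=
  if h : (P.filter (fun y => x < y)).Nonempty then (P.filter (fun y => x < y)).min' h
  else if h2 : P.Nonempty then P.min' h2 else 0

open scoped Classical in
/-- The cyclic interval of `P` from `u` to `v`: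
`{u, S_P(u), …, S_P^m(u)}` where `m ≥ 0` is minimal with `S_P^m(u) = v`. -/
noncomputable def cyclicIntervalTo (P : Finset ℕ) (u v : ℕ) : Finset ℕ :=
  if h : ∃ m : ℕ, (cyclicSucc P)^[m] u = v then
    (Finset.range (Nat.find h + 1)).image (fun j => (cyclicSucc P)^[j] u)
  else ∅

/-- The orbit `ā = {a + iℓ : 0 ≤ i ≤ d−1} ⊆ [dℓ]` of `a ∈ [ℓ]`. -/
def orbit (d ℓ a : ℕ) : Finset ℕ := (Finset.range d).image (fun i => a + i * ℓ)

/-- `P_s = [n] \ (ā_{a_1} ∪ … ∪ ā_{a_{s−1}})`, where `n = dℓ`. -/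
def Pset (d ℓ : ℕ) (a : ℕ → ℕ) (s : ℕ) : Finset ℕ :=
  Finset.Icc 1 (d * ℓ) \ (Finset.Icc 1 (s - 1)).biUnion (fun i => orbit d ℓ (a i))

/-- `P_{s,h} = P_s \ {a_s +_n hℓ, …, a_s +_n (d−1)ℓ}` for `1 ≤ h ≤ d−1`; `P_{s,d} = P_s`. -/
def Psh (d ℓ : ℕ) (a : ℕ → ℕ) (s h : ℕ) : Finset ℕ :=
  Pset d ℓ a s \ (Finset.Ico h d).image (fun j => shiftMod (d * ℓ) (j * ℓ) (a s))

/-- `I(i,h) = {i, S_{P_{s,h}}(i), S_{P_{s,h}}²(i), …, S_{P_{s,h}}^{k−1}(i)}`. -/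
def Iih (d ℓ k : ℕ) (a : ℕ → ℕ) (s h i : ℕ) : Finset ℕ :=
  (Finset.range k).image (fun j => (cyclicSucc (Psh d ℓ a s h))^[j] i)

/-- `B_s = {I(i,h) : i` in the cyclic interval of `P_s` from `S_{P_s}(a_s +_n (n−ℓ))` to
`a_s`, `1 ≤ h ≤ d`, `|I(i,h)| = k}`. -/
noncomputable def Bset (d ℓ k : ℕ) (a : ℕ → ℕ) (s : ℕ) : Finset (Finset ℕ) :=
  (((cyclicIntervalTo (Pset d ℓ a s)
        (cyclicSucc (Pset d ℓ a s) (shiftMod (d * ℓ) (d * ℓ - ℓ) (a s)))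
        (a s)) ×ˢ (Finset.Icc 1 d)).image
      (fun p => Iih d ℓ k a s p.2 p.1)).filter (fun I => I.card = k)

/-- `L_s = {I +_n xℓ : I ∈ B_s, 1 ≤ x ≤ d}`. -/
noncomputable def Lset (d ℓ k : ℕ) (a : ℕ → ℕ) (s : ℕ) : Finset (Finset ℕ) :=
  ((Bset d ℓ k a s) ×ˢ (Finset.Icc 1 d)).image (fun p => shiftSet (d * ℓ) (p.2 * ℓ) p.1)

/-- The output collection `D = L_1 ∪ … ∪ L_{ℓ−r+1}`. -/
noncomputable def Dcol (d ℓ k r : ℕ) (a : ℕ → ℕ) : Finset (Finset ℕ) :=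
  (Finset.Icc 1 (ℓ - r + 1)).biUnion (fun s => Lset d ℓ k a s)

/-- The map `F : [n] → [dℓ]`, `F(a + gx) = a + ℓx` for `1 ≤ a ≤ g`, `0 ≤ x ≤ d−1`. -/
def Fmap (g ℓ y : ℕ) : ℕ := (y - 1) % g + 1 + ℓ * ((y - 1) / g)

/-- The cyclic distance from `u` to `x` in `[n]`. -/
def cyclicDist (n u x : ℕ) : ℕ := if u ≤ x then x - u else x + n - u

/-- Shift `x ∈ [n]` backwards by `t ≤ n` modulo `n`. -/
def shiftBack (n t x : ℕ) : ℕ := if t < x then x - t else x + n - t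

lemma shiftMod_eq_ite {n t x : ℕ} (hx1 : 1 ≤ x) (hxn : x ≤ n) (ht : t < n) :
    shiftMod n t x = if x + t ≤ n then x + t else x + t - n := by
  unfold shiftMod
  split_ifs with h
  · rw [Nat.mod_eq_of_lt (by omega)]; omega
  · rw [Nat.mod_eq_sub_mod (by omega), Nat.mod_eq_of_lt (by omega)]; omega

lemma WeaklySeparated.symm {S T : Finset ℕ} (h : WeaklySeparated S T) : WeaklySeparated T S := by
  rintro ⟨a, b, c, d, h1, h2, h3, h4⟩
  exact h ⟨a, b, c, d, h1, h2, h3, h4.symm⟩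

lemma weaklySeparated_of_cyclicDist {n u t : ℕ} {S T : Finset ℕ} (hun : u ≤ n)
    (hS : ∀ p ∈ S \ T, 1 ≤ p ∧ p ≤ n ∧ cyclicDist n u p < t)
    (hT : ∀ p ∈ T \ S, 1 ≤ p ∧ p ≤ n ∧ t ≤ cyclicDist n u p) : WeaklySeparated S T := by
  unfold cyclicDist at hS hT
  rintro ⟨a, b, c, d, h1, h2, h3, ⟨ha, hc, hb, hd⟩ | ⟨ha, hc, hb, hd⟩⟩
  · have := hS a ha; have := hS c hc; have := hT b hb; have := hT d hd
    grind
  · have := hT a ha; have := hT c hc; have := hS b hb; have := hS d hd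
    grind

lemma cyclicSucc_spec {P : Finset ℕ} (hP : P.Nonempty) (x : ℕ) :
    cyclicSucc P x ∈ P ∧
      ((x < cyclicSucc P x ∧ ∀ z ∈ P, x < z → cyclicSucc P x ≤ z) ∨
        ∀ z ∈ P, z ≤ x ∧ cyclicSucc P x ≤ z) := by
  unfold cyclicSucc
  split_ifs with h
  · have hm := Finset.mem_filter.1 (Finset.min'_mem _ h)
    refine ⟨hm.1, Or.inl ⟨hm.2, fun z hz hxz => ?_⟩⟩
    exact Finset.min'_le _ _ (Finset.mem_filter.2 ⟨hz, hxz⟩)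
  · refine ⟨Finset.min'_mem _ _, Or.inr fun z hz => ⟨?_, Finset.min'_le _ _ hz⟩⟩
    by_contra hlt
    exact h ⟨z, Finset.mem_filter.2 ⟨hz, by omega⟩⟩

lemma iterate_cyclicSucc_mem {P : Finset ℕ} {i : ℕ} (hi : i ∈ P) (j : ℕ) :
    (cyclicSucc P)^[j] i ∈ P := by
  induction j with
  | zero => exact hi
  | succ j _ =>
    rw [Function.iterate_succ_apply']
    exact (cyclicSucc_spec ⟨i, hi⟩ _).1

lemma cyclicDist_cyclicSucc_lt {n x v : ℕ} {P : Finset ℕ} (hP : ∀ z ∈ P, 1 ≤ z ∧ z ≤ n)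
    (hv : v ∈ P) (hxn : x ≤ n) (hne : x ≠ v) :
    cyclicDist n (cyclicSucc P x) v < cyclicDist n x v := by
  obtain ⟨hm, h⟩ := cyclicSucc_spec ⟨v, hv⟩ x
  have h1 := hP _ hm
  have h2 := hP _ hv
  unfold cyclicDist
  rcases h with ⟨h3, h4⟩ | h3
  · have := h4 v hv
    split_ifs <;> omega
  · have := h3 v hv
    split_ifs <;> omega

/-- The orbit of `i` under the cyclic successor lists the elements of `P` by increasing cyclic
distance from `i`. -/
lemma exists_iterate_cyclicSucc_eq {n i : ℕ} {P : Finset ℕ} (hP : ∀ z ∈ P, 1 ≤ z ∧ z ≤ n)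
    (hi : i ∈ P) {z : ℕ} (hz : z ∈ P) (j : ℕ)
    (h : cyclicDist n i z ≤ cyclicDist n i ((cyclicSucc P)^[j] i)) :
    ∃ j' ≤ j, (cyclicSucc P)^[j'] i = z := by
  have hi' := hP _ hi
  have hz' := hP _ hz
  induction j with
  | zero =>
    refine ⟨0, le_rfl, ?_⟩
    simp only [Function.iterate_zero, id_eq, cyclicDist, le_refl, if_true] at h ⊢
    split_ifs at h <;> omega
  | succ j ih =>
    by_cases hle : cyclicDist n i z ≤ cyclicDist n i ((cyclicSucc P)^[j] i)
    · obtain ⟨j', hj', e⟩ := ih hle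
      exact ⟨j', by omega, e⟩
    · refine ⟨j + 1, le_rfl, ?_⟩
      rw [Function.iterate_succ_apply'] at h ⊢
      have hx := iterate_cyclicSucc_mem hi j
      generalize (cyclicSucc P)^[j] i = x at *
      have hx' := hP _ hx
      obtain ⟨hm, hs⟩ := cyclicSucc_spec ⟨i, hi⟩ x
      have hm' := hP _ hm
      unfold cyclicDist at h hle
      rcases hs with ⟨h3, h4⟩ | h3
      · have := h4 z hz; have := h4 i hi
        split_ifs at h hle <;> omega
      · have := h3 z hz; have := h3 i hi
        split_ifs at h hle <;> omega

lemma cyclicIntervalTo_spec {n u v i B : ℕ} {P : Finset ℕ} (hP : ∀ z ∈ P, 1 ≤ z ∧ z ≤ n)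
    (hu : u ∈ P) (hv : v ∈ P) (hB : cyclicDist n u v < B) (hi : i ∈ cyclicIntervalTo P u v) :
    i ∈ P ∧ cyclicDist n i v < B := by
  classical
  unfold cyclicIntervalTo at hi
  split_ifs at hi with h
  · obtain ⟨j, hj, rfl⟩ := Finset.mem_image.1 hi
    rw [Finset.mem_range] at hj
    refine ⟨iterate_cyclicSucc_mem hu j, ?_⟩
    clear hi
    induction j with
    | zero => exact hB
    | succ j ih =>
      rw [Function.iterate_succ_apply']
      have hne := Nat.find_min h (m := j) (by omega)
      have := cyclicDist_cyclicSucc_lt hP hv (hP _ (iterate_cyclicSucc_mem hu j)).2 hne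
      have := ih (by omega)
      omega
  · simp at hi

lemma mem_Pset {d ℓ s y : ℕ} {a : ℕ → ℕ} :
    y ∈ Pset d ℓ a s ↔ (1 ≤ y ∧ y ≤ d * ℓ) ∧
      ∀ i, 1 ≤ i → i ≤ s - 1 → ∀ j < d, a i + j * ℓ ≠ y := by
  simp only [Pset, orbit, Finset.mem_sdiff, Finset.mem_Icc, Finset.mem_biUnion, Finset.mem_image,
    Finset.mem_range]
  refine and_congr_right fun _ => ⟨fun H i h1 h2 j hj e => H ⟨i, ⟨h1, h2⟩, j, hj, e⟩, ?_⟩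
  rintro H ⟨i, ⟨h1, h2⟩, j, hj, e⟩
  exact H i h1 h2 j hj e

lemma shiftMod_mul_eq {d ℓ j b : ℕ} (hb1 : 1 ≤ b) (hb : b ≤ ℓ) (hj : j < d) :
    shiftMod (d * ℓ) (j * ℓ) b = b + j * ℓ := by
  have h : (j + 1) * ℓ ≤ d * ℓ := Nat.mul_le_mul_right _ hj
  rw [add_mul, one_mul] at h
  rw [shiftMod_eq_ite hb1 (by omega) (by omega), if_pos (by omega)]

lemma mem_Psh {d ℓ s h y : ℕ} {a : ℕ → ℕ} (h1 : 1 ≤ a s) (h2 : a s ≤ ℓ) :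
    y ∈ Psh d ℓ a s h ↔ y ∈ Pset d ℓ a s ∧ ∀ j, h ≤ j → j < d → a s + j * ℓ ≠ y := by
  simp only [Psh, Finset.mem_sdiff, Finset.mem_image, Finset.mem_Ico]
  refine and_congr_right fun _ => ⟨fun H j hj hjd e => H ⟨j, ⟨hj, hjd⟩, ?_⟩, ?_⟩
  · rw [shiftMod_mul_eq h1 h2 hjd, e]
  · rintro H ⟨j, ⟨hj, hjd⟩, e⟩
    rw [shiftMod_mul_eq h1 h2 hjd] at e
    exact H j hj hjd e

/-- If shifting `x` back by `ℓ` gives `b + jℓ`, then `x` is the next element of the orbit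
of `b`. -/
lemma eq_of_shiftBack_eq {d ℓ b x j : ℕ} (hb1 : 1 ≤ b) (hb : b ≤ ℓ) (hx1 : 1 ≤ x)
    (hxn : x ≤ d * ℓ) (hj : j < d) (e : b + j * ℓ = shiftBack (d * ℓ) ℓ x) :
    (j + 1 < d ∧ b + (j + 1) * ℓ = x) ∨ (j + 1 = d ∧ b = x) := by
  have hjd : (j + 1) * ℓ ≤ d * ℓ := Nat.mul_le_mul_right _ hj
  rcases Nat.lt_or_ge (j + 1) d with h | h
  · have hjd' : (j + 1 + 1) * ℓ ≤ d * ℓ := Nat.mul_le_mul_right _ h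
    refine Or.inl ⟨h, ?_⟩
    simp only [add_mul, one_mul] at hjd hjd' ⊢
    unfold shiftBack at e
    split_ifs at e <;> omega
  · obtain rfl : d = j + 1 := by omega
    refine Or.inr ⟨rfl, ?_⟩
    simp only [add_mul, one_mul] at e hjd hxn
    unfold shiftBack at e
    split_ifs at e <;> omega

lemma shiftBack_mem_Pset {d ℓ s x : ℕ} {a : ℕ → ℕ}
    (ha : ∀ i, 1 ≤ i → i ≤ s - 1 → 1 ≤ a i ∧ a i ≤ ℓ) (hd : 1 ≤ d)
    (hx : x ∈ Pset d ℓ a s) : shiftBack (d * ℓ) ℓ x ∈ Pset d ℓ a s := by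
  rw [mem_Pset] at hx ⊢
  obtain ⟨hx1, hx2⟩ := hx
  have hdl : 1 * ℓ ≤ d * ℓ := Nat.mul_le_mul_right _ hd
  refine ⟨?_, fun i hi hi' j hj e => ?_⟩
  · unfold shiftBack
    split_ifs <;> omega
  · rcases eq_of_shiftBack_eq (ha i hi hi').1 (ha i hi hi').2 hx1.1 hx1.2 hj e with ⟨h, e⟩ | ⟨-, e⟩
    · exact hx2 i hi hi' _ h e
    · exact hx2 i hi hi' 0 (by omega) (by omega)

/-- If `I` is closed under shifting back by `ℓ` as long as this does not pass the base point `i`,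
then it is closed under shifting back by multiples of `ℓ` not passing `i`. -/
lemma shiftBack_mul_mem {n ℓ i : ℕ} {I : Finset ℕ} (hi1 : 1 ≤ i) (hin : i ≤ n)
    (hI : ∀ x ∈ I, 1 ≤ x ∧ x ≤ n)
    (hback : ∀ x ∈ I, ℓ ≤ cyclicDist n i x → shiftBack n ℓ x ∈ I) (m : ℕ) :
    ∀ x ∈ I, m * ℓ ≤ cyclicDist n i x → shiftBack n (m * ℓ) x ∈ I := by
  induction m with
  | zero =>
    intro x hx _
    have := hI x hx
    rw [zero_mul, shiftBack, if_pos (by omega), Nat.sub_zero]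
    exact hx
  | succ m ih =>
    intro x hx h
    have hx' := hI x hx
    rw [add_mul, one_mul] at h ⊢
    generalize m * ℓ = t at *
    have h1 := hback _ (ih x hx (by omega))
    have e : shiftBack n ℓ (shiftBack n t x) = shiftBack n (t + ℓ) x := by
      unfold cyclicDist at h
      unfold shiftBack
      split_ifs at h ⊢ <;> omega
    rw [e] at h1
    apply h1
    unfold cyclicDist at h ⊢
    unfold shiftBack
    split_ifs at h ⊢ <;> omega

lemma weaklySeparated_shiftSet {d ℓ i : ℕ} (hl : 1 ≤ ℓ) {I : Finset ℕ} (hi1 : 1 ≤ i)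
    (hin : i ≤ d * ℓ) (hI : ∀ x ∈ I, 1 ≤ x ∧ x ≤ d * ℓ)
    (hback : ∀ x ∈ I, ℓ ≤ cyclicDist (d * ℓ) i x → shiftBack (d * ℓ) ℓ x ∈ I)
    {x y : ℕ} (hxy : x ≤ y) (hy : y < d) :
    WeaklySeparated (shiftSet (d * ℓ) (x * ℓ) I) (shiftSet (d * ℓ) (y * ℓ) I) := by
  have hb := shiftBack_mul_mem hi1 hin hI hback
  have hb1 := hb (y - x)
  have hb2 := hb (d - (y - x))
  have hXY : x * ℓ ≤ y * ℓ := Nat.mul_le_mul_right _ hxy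
  have hYn : y * ℓ < d * ℓ := Nat.mul_lt_mul_of_pos_right hy hl
  rw [Nat.sub_mul] at hb1
  rw [Nat.sub_mul, Nat.sub_mul] at hb2
  generalize d * ℓ = n at *
  generalize x * ℓ = X at *
  generalize y * ℓ = Y at *
  apply weaklySeparated_of_cyclicDist (n := n) (u := shiftMod n X i) (t := Y - X)
  · rw [shiftMod_eq_ite hi1 hin (by omega)]; split_ifs <;> omega
  · intro p hp
    obtain ⟨hp1, hp2⟩ := Finset.mem_sdiff.1 hp
    obtain ⟨z, hz, rfl⟩ := Finset.mem_image.1 hp1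
    have hz' := hI z hz
    rw [shiftMod_eq_ite hi1 hin (by omega)]
    rw [shiftMod_eq_ite hz'.1 hz'.2 (by omega)] at hp2 ⊢
    refine ⟨by split_ifs <;> omega, by split_ifs <;> omega, ?_⟩
    by_contra hlt
    have hle : Y - X ≤ cyclicDist n i z := by
      unfold cyclicDist at hlt ⊢
      split_ifs at hlt ⊢ <;> omega
    have hw := hb1 z hz hle
    have hw' := hI _ hw
    apply hp2
    refine Finset.mem_image.2 ⟨_, hw, ?_⟩
    rw [shiftMod_eq_ite hw'.1 hw'.2 (by omega)]
    unfold shiftBack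
    split_ifs <;> omega
  · intro p hp
    obtain ⟨hp1, hp2⟩ := Finset.mem_sdiff.1 hp
    obtain ⟨z, hz, rfl⟩ := Finset.mem_image.1 hp1
    have hz' := hI z hz
    rw [shiftMod_eq_ite hi1 hin (by omega)]
    rw [shiftMod_eq_ite hz'.1 hz'.2 (by omega)] at hp2 ⊢
    refine ⟨by split_ifs <;> omega, by split_ifs <;> omega, ?_⟩
    by_contra hlt
    have hle : n - (Y - X) ≤ cyclicDist n i z := by
      unfold cyclicDist at hlt ⊢
      split_ifs at hlt ⊢ <;> omega
    have hw := hb2 z hz hle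
    have hw' := hI _ hw
    apply hp2
    refine Finset.mem_image.2 ⟨_, hw, ?_⟩
    rw [shiftMod_eq_ite hw'.1 hw'.2 (by omega)]
    unfold shiftBack
    split_ifs <;> omega

lemma weaklySeparated_of_card_le_one {S T : Finset ℕ} (hS : S.card ≤ 1) :
    WeaklySeparated S T := by
  rw [Finset.card_le_one] at hS
  rintro ⟨a, b, c, d, h1, h2, h3, ⟨ha, hc, -, -⟩ | ⟨-, -, hb, hd⟩⟩
  · have := hS _ (Finset.mem_sdiff.1 ha).1 _ (Finset.mem_sdiff.1 hc).1
    omega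
  · have := hS _ (Finset.mem_sdiff.1 hb).1 _ (Finset.mem_sdiff.1 hd).1
    omega

/-- With the algorithm setup (`n = dℓ`, `k = dr + c`, `c ∈ {−1,0,1}`):
for any `1 ≤ s ≤ ℓ − r + 1` and any `I ∈ B_s`, the collection of `ρ^ℓ`-translates
`{I +_n xℓ : 0 ≤ x ≤ d − 1}` is weakly separated. -/
theorem stmt12 (d ℓ k : ℕ) (hd : 1 ≤ d) (hl : 1 ≤ ℓ) (hk1 : 1 ≤ k) (hk2 : 2 * k ≤ d * ℓ)
    (a : ℕ → ℕ) (ha : Set.BijOn a (Set.Icc 1 ℓ) (Set.Icc 1 ℓ))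
    (r : ℕ) (c : ℤ) (hc : c = -1 ∨ c = 0 ∨ c = 1) (hk : (k : ℤ) = d * r + c)
    (s : ℕ) (hs1 : 1 ≤ s) (hs2 : s ≤ ℓ - r + 1)
    (I : Finset ℕ) (hI : I ∈ Bset d ℓ k a s) :
    ∀ x y : ℕ, x ≤ d - 1 → y ≤ d - 1 →
      WeaklySeparated (shiftSet (d * ℓ) (x * ℓ) I) (shiftSet (d * ℓ) (y * ℓ) I) := by
  intro x y hx hy
  obtain ⟨hIm, hcard⟩ := Finset.mem_filter.1 hI
  rcases Nat.lt_or_ge ℓ s with hsl | hsl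
  · have hr : r = 0 := by omega
    subst hr
    apply weaklySeparated_of_card_le_one
    refine Finset.card_image_le.trans ?_
    rw [hcard]
    simp only [Nat.cast_zero, mul_zero, zero_add] at hk
    omega
  rcases Nat.lt_or_ge d 2 with hd2 | hd2
  · obtain rfl : x = y := by omega
    rintro ⟨_, _, _, _, -, -, -, ⟨h, -⟩ | ⟨h, -⟩⟩ <;> simp at h
  obtain ⟨⟨i, h⟩, hih, rfl⟩ := Finset.mem_image.1 hIm
  obtain ⟨hi, hh⟩ := Finset.mem_product.1 hih
  simp only [Finset.mem_Icc] at hi hh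
  have haI : ∀ i, 1 ≤ i → i ≤ ℓ → 1 ≤ a i ∧ a i ≤ ℓ := fun i h1 h2 => ha.mapsTo ⟨h1, h2⟩
  obtain ⟨has1, hasl⟩ := haI s hs1 hsl
  have hdl : 2 * ℓ ≤ d * ℓ := Nat.mul_le_mul_right _ hd2
  have hPn : ∀ z ∈ Pset d ℓ a s, 1 ≤ z ∧ z ≤ d * ℓ := fun z hz => (mem_Pset.1 hz).1
  have hasP : a s ∈ Pset d ℓ a s := by
    refine mem_Pset.2 ⟨⟨has1, by omega⟩, fun i h1 h2 j hj e => ?_⟩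
    have hai := haI i h1 (by omega)
    rcases Nat.eq_zero_or_pos j with rfl | hj0
    · have := ha.injOn (Set.mem_Icc.2 ⟨h1, by omega⟩) (Set.mem_Icc.2 ⟨hs1, hsl⟩) (by omega)
      omega
    · have : 1 * ℓ ≤ j * ℓ := Nat.mul_le_mul_right _ hj0
      omega
  obtain ⟨hiP, hia⟩ := cyclicIntervalTo_spec (B := ℓ) hPn
    (cyclicSucc_spec ⟨_, hasP⟩ _).1 hasP (by
      rw [shiftMod_eq_ite has1 (by omega) (by omega)]
      refine (cyclicDist_cyclicSucc_lt hPn hasP ?_ ?_).trans_le ?_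
      · split_ifs <;> omega
      · split_ifs <;> omega
      · unfold cyclicDist
        split_ifs <;> omega) hi
  have hiP' : i ∈ Psh d ℓ a s h := by
    refine (mem_Psh has1 hasl).2 ⟨hiP, fun j hj hjd e => ?_⟩
    have h1 : 1 * ℓ ≤ j * ℓ := Nat.mul_le_mul_right _ (by omega)
    have h2 : (j + 1) * ℓ ≤ d * ℓ := Nat.mul_le_mul_right _ hjd
    rw [add_mul] at h2
    unfold cyclicDist at hia
    split_ifs at hia <;> omega
  have hPhn : ∀ z ∈ Psh d ℓ a s h, 1 ≤ z ∧ z ≤ d * ℓ :=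
    fun z hz => hPn z ((mem_Psh has1 hasl).1 hz).1
  have hsub : ∀ z ∈ Iih d ℓ k a s h i, z ∈ Psh d ℓ a s h := by
    intro z hz
    obtain ⟨j, -, rfl⟩ := Finset.mem_image.1 hz
    exact iterate_cyclicSucc_mem hiP' j
  have hback : ∀ z ∈ Iih d ℓ k a s h i, ℓ ≤ cyclicDist (d * ℓ) i z →
      shiftBack (d * ℓ) ℓ z ∈ Iih d ℓ k a s h i := by
    intro z hz hle
    have hzP := (mem_Psh has1 hasl).1 (hsub z hz)
    have hz1 := hPn z hzP.1
    have hi1 := hPn i hiP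
    have hwP : shiftBack (d * ℓ) ℓ z ∈ Psh d ℓ a s h := by
      refine (mem_Psh has1 hasl).2 ⟨shiftBack_mem_Pset
        (fun i h1 h2 => haI i h1 (by omega)) hd hzP.1, fun j hj hjd e => ?_⟩
      rcases eq_of_shiftBack_eq has1 hasl hz1.1 hz1.2 hjd e with ⟨h1, e⟩ | ⟨-, rfl⟩
      · exact hzP.2 _ (by omega) h1 e
      · omega
    obtain ⟨j, hj, rfl⟩ := Finset.mem_image.1 hz
    obtain ⟨j', hj', e⟩ := exists_iterate_cyclicSucc_eq hPhn hiP' hwP j (by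
      generalize (cyclicSucc (Psh d ℓ a s h))^[j] i = w at *
      unfold cyclicDist at hle ⊢
      unfold shiftBack
      split_ifs at hle ⊢ <;> omega)
    rw [Finset.mem_range] at hj
    exact Finset.mem_image.2 ⟨j', Finset.mem_range.2 (by omega), e⟩
  have hi1 := hPn i hiP
  rcases le_total x y with hxy | hxy
  · exact weaklySeparated_shiftSet hl hi1.1 hi1.2 (fun z hz => hPhn z (hsub z hz)) hback hxy
      (by omega)
  · exact (weaklySeparated_shiftSet hl hi1.1 hi1.2 (fun z hz => hPhn z (hsub z hz)) hback hxy
      (by omega)).symm
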